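/- Let N, E, Q be groups fitting in a short exact sequence 1 → N → E → Q → 1 with N having trivial center, and let ρ: Q → Out(N) = Aut(N)/Inn(N) be the induced outer action (sending q ∈ Q to conjugation by any preimage in E, which is well-defined in Out(N)). Then E is isomorphic, compatibly with the maps to Q and from N, to the fiber product Aut(N) ×_{Out(N)} Q of the canonical projection Aut(N) → Out(N) and ρ: Q → Out(N); that is, the extension 1 → N → E → Q → 1 is equivalent to the pullback along ρ of the extension 1 → N → Aut(N) → Out(N) → 1 (where N → Aut(N) is the injection by inner automorphisms, which is injective since N is centre-free). -/

import Mathlib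

/-!
STATEMENT 3: If `1 → N → E → Q → 1` is a short exact sequence of groups with `N`
centre-free, and `ρ : Q → Out N` is the induced outer action, then `E` is isomorphic,
compatibly with the maps from `N` and to `Q`, to the fiber product
`Aut N ×_{Out N} Q` of `Aut N → Out N` and `ρ`.
-/

/-- The subgroup `Inn N ≤ Aut N` of inner automorphisms, i.e. the range of the
conjugation homomorphism `N →* MulAut N`. -/
def innSubgroup (N : Type*) [Group N] : Subgroup (MulAut N) :=
  (MulAut.conj : N →* MulAut N).range

instance innSubgroup_normal (N : Type*) [Group N] : (innSubgroup N).Normal := by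
  constructor
  rintro - ⟨n, rfl⟩ φ
  refine ⟨φ n, ?_⟩
  ext m
  simp [MulAut.conj, mul_assoc]

/-- The outer automorphism group `Out N = Aut N / Inn N`. -/
abbrev OutAut (N : Type*) [Group N] := MulAut N ⧸ innSubgroup N

/-- The fiber product `Aut N ×_{Out N} Q` of the canonical projection
`Aut N → Out N` and an outer action `ρ : Q → Out N`, as a subgroup of `Aut N × Q`. -/
def fiberProduct {N Q : Type*} [Group N] [Group Q] (ρ : Q →* OutAut N) :
    Subgroup (MulAut N × Q) where
  carrier := {p | QuotientGroup.mk' (innSubgroup N) p.1 = ρ p.2}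
  one_mem' := by simp
  mul_mem' := by
    intro a b ha hb
    simp only [Set.mem_setOf_eq, Prod.fst_mul, Prod.snd_mul, map_mul] at *
    rw [ha, hb]
  inv_mem' := by
    intro a ha
    simp only [Set.mem_setOf_eq, Prod.fst_inv, Prod.snd_inv, map_inv] at *
    rw [ha]

/-- The action of `E` by conjugation on `N`, embedded in `E` with normal image. -/
noncomputable def conjOfNormalRange {N E : Type*} [Group N] [Group E] (i : N →* E)
    (hi : Function.Injective i) (hn : i.range.Normal) : E →* MulAut N :=
  haveI := hn
  (MulAut.congr (MonoidHom.ofInjective hi).symm).toMonoidHom.comp MulAut.conjNormal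

theorem apply_conjOfNormalRange {N E : Type*} [Group N] [Group E] (i : N →* E)
    (hi : Function.Injective i) (hn : i.range.Normal) (e : E) (n : N) :
    i (conjOfNormalRange i hi hn e n) = e * i n * e⁻¹ := by
  have := hn
  change i ((MonoidHom.ofInjective hi).symm
    (MulAut.conjNormal e (MonoidHom.ofInjective hi n))) = _
  rw [MonoidHom.apply_ofInjective_symm, MulAut.conjNormal_apply, MonoidHom.ofInjective_apply]

theorem conjOfNormalRange_apply_self {N E : Type*} [Group N] [Group E] (i : N →* E)
    (hi : Function.Injective i) (hn : i.range.Normal) (n : N) :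
    conjOfNormalRange i hi hn (i n) = MulAut.conj n := by
  ext m
  apply hi
  simp [apply_conjOfNormalRange]

theorem conj_injective_of_center_eq_bot {N : Type*} [Group N]
    (hcf : Subgroup.center N = ⊥) :
    Function.Injective (MulAut.conj : N →* MulAut N) := by
  rw [injective_iff_map_eq_one]
  intro n hn
  rw [← Subgroup.mem_bot, ← hcf, Subgroup.mem_center_iff]
  intro m
  have h := DFunLike.congr_fun hn m
  rw [MulAut.conj_apply, MulAut.one_apply, mul_inv_eq_iff_eq_mul] at h
  exact h.symm

theorem extension_eq_pullback_of_centerfree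
    {N E Q : Type*} [Group N] [Group E] [Group Q]
    (i : N →* E) (π : E →* Q)
    (hi : Function.Injective i) (hπ : Function.Surjective π)
    (hexact : i.range = π.ker)
    (hcf : Subgroup.center N = ⊥)
    (ρ : Q →* OutAut N)
    -- `ρ` is the outer action induced by the extension: for `e : E`, any automorphism `ν` of
    -- `N` realizing conjugation by `e` on `i(N)` represents `ρ (π e)` in `Out N`.
    (hρ : ∀ (e : E) (ν : MulAut N),
      (∀ n : N, i (ν n) = e * i n * e⁻¹) →
      ρ (π e) = QuotientGroup.mk' (innSubgroup N) ν) :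
    -- conclusion: `E` is isomorphic to the fiber product, compatibly with the maps
    -- to `Q` and from `N` (where `N → Aut N` is the injection by inner automorphisms).
    ∃ Φ : E ≃* (fiberProduct ρ),
      (∀ e : E, ((Φ e : MulAut N × Q)).2 = π e) ∧
      (∀ n : N, ((Φ (i n) : MulAut N × Q)).1 = MulAut.conj n) := by
  have hn : i.range.Normal := hexact ▸ π.normal_ker
  let c := conjOfNormalRange i hi hn
  have hρc (e : E) : ρ (π e) = QuotientGroup.mk' (innSubgroup N) (c e) :=
    hρ e (c e) (apply_conjOfNormalRange i hi hn e)
  have hci (n : N) : c (i n) = MulAut.conj n := conjOfNormalRange_apply_self i hi hn n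
  have hπi (n : N) : π (i n) = 1 := by
    rw [← MonoidHom.mem_ker, ← hexact]
    exact ⟨n, rfl⟩
  let f : E →* fiberProduct ρ := (c.prod π).codRestrict _ fun e => (hρc e).symm
  have hf : Function.Bijective f := by
    constructor
    · rw [injective_iff_map_eq_one]
      intro e he
      have he' : (c e, π e) = 1 := congrArg Subtype.val he
      obtain ⟨h₁, h₂⟩ := Prod.mk_eq_one.mp he'
      rw [← MonoidHom.mem_ker, ← hexact] at h₂
      obtain ⟨n, rfl⟩ := h₂
      rw [hci] at h₁
      rw [(map_eq_one_iff _ (conj_injective_of_center_eq_bot hcf)).mp h₁, map_one]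
    · rintro ⟨⟨α, q⟩, h⟩
      obtain ⟨e, rfl⟩ := hπ q
      have h' : QuotientGroup.mk' (innSubgroup N) α = ρ (π e) := h
      rw [hρc] at h'
      obtain ⟨n, hα⟩ : (c e)⁻¹ * α ∈ innSubgroup N := QuotientGroup.eq.mp h'.symm
      refine ⟨e * i n, Subtype.ext (Prod.ext ?_ ?_)⟩
      · change c (e * i n) = α
        rw [map_mul, hci, hα, mul_inv_cancel_left]
      · change π (e * i n) = π e
        rw [map_mul, hπi, mul_one]
  exact ⟨MulEquiv.ofBijective f hf, fun _ => rfl, hci⟩
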